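/- arXiv:2008.00200 — 3 statements merged into one kernel-verified Lean document; each statement's English description precedes it below -/
import Mathlib

section
/- Suppose q ≥ 5. Then the set {e} ∪ P_0, where e is the identity matrix, separates the G-orbitals: for any two distinct elements h₁, h₂ ∈ H \ ({e} ∪ P_0) there exists s ∈ {e} ∪ P_0 such that s·h₁⁻¹ and s·h₂⁻¹ lie in distinct orbits of the conjugation action of D on H. -/
open Matrix Pointwise

abbrev SL3 (F : Type*) [Field F] := Matrix.SpecialLinearGroup (Fin 3) F

variable (F : Type*) [Field F]

/-- The subgroup `G` of `SL₃(F)`, as a set of matrices. -/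
def GSet : Set (SL3 F) :=
  {g | ∃ a b c x y z : F, (a = 1 ∨ a = -1) ∧ (b = 1 ∨ b = -1) ∧ (c = 1 ∨ c = -1) ∧
    a * b * c = 1 ∧ (g : Matrix (Fin 3) (Fin 3) F) = !![a, x, z; 0, b, y; 0, 0, c]}

/-- The subgroup `D` of `SL₃(F)`, as a set of matrices. -/
def DSet : Set (SL3 F) :=
  {g | ∃ a x : F, (a = 1 ∨ a = -1) ∧
    (g : Matrix (Fin 3) (Fin 3) F) = !![a, a * x, a * x ^ 2 / 2; 0, 1, x; 0, 0, a]}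

/-- The matrix `h(a,x,y)`. -/
def hMat (a x y : F) : Matrix (Fin 3) (Fin 3) F := !![a, 0, x; 0, a, y; 0, 0, 1]

/-- The subgroup `H` of `SL₃(F)`, as a set of matrices. -/
def HSet : Set (SL3 F) :=
  {g | ∃ a x y : F, (a = 1 ∨ a = -1) ∧ (g : Matrix (Fin 3) (Fin 3) F) = hMat F a x y}

/-- The subgroup `K` of `SL₃(F)`, as a set of matrices. -/
def KSet : Set (SL3 F) :=
  {g | ∃ a x y : F, (a = 1 ∨ a = -1) ∧
    (g : Matrix (Fin 3) (Fin 3) F) = !![1, x, y; 0, a, 0; 0, 0, a]}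

/-- The singleton set `S_t = {h(1,t,0)}`. -/
def Sorb (t : F) : Set (SL3 F) := {g | (g : Matrix (Fin 3) (Fin 3) F) = hMat F 1 t 0}

/-- The set `C_t = {h(1,z,t) : z ∈ F}`. -/
def Corb (t : F) : Set (SL3 F) := {g | ∃ z : F, (g : Matrix (Fin 3) (Fin 3) F) = hMat F 1 z t}

/-- The parabolic set `P_t = {h(-1,t+z²,2z) : z ∈ F}`. -/
def Porb (t : F) : Set (SL3 F) :=
  {g | ∃ z : F, (g : Matrix (Fin 3) (Fin 3) F) = hMat F (-1) (t + z ^ 2) (2 * z)}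

/-- The orbit of `h` under the conjugation action of `D`. -/
def DOrbit (h : SL3 F) : Set (SL3 F) := {h' | ∃ d ∈ DSet F, h' = d⁻¹ * h * d}

section HElements

variable {F}

/-- The element `h(a,x,y)` of `SL₃(F)`. -/
def hElt (a x y : F) (ha : a * a = 1) : SL3 F :=
  ⟨hMat F a x y, by simp [hMat, Matrix.det_fin_three, ha]⟩

lemma hElt_mul (a x y b u v : F) (ha : a * a = 1) (hb : b * b = 1) :
    hElt a x y ha * hElt b u v hb =
      hElt (a * b) (a * u + x) (a * v + y) (by rw [mul_mul_mul_comm, ha, hb, mul_one]) := by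
  apply Subtype.ext
  change hMat F a x y * hMat F b u v = hMat F (a * b) (a * u + x) (a * v + y)
  ext i j
  fin_cases i <;> fin_cases j <;> simp [hMat, Matrix.mul_apply, Fin.sum_univ_three]

lemma hElt_inv (a x y : F) (ha : a * a = 1) :
    (hElt a x y ha)⁻¹ = hElt a (-(a * x)) (-(a * y)) ha := by
  rw [inv_eq_iff_mul_eq_one, hElt_mul]
  apply Subtype.ext
  change hMat F (a * a) _ _ = 1
  ext i j
  fin_cases i <;> fin_cases j <;> simp [hMat, ← mul_assoc, ha]

lemma mul_self_eq_one_of_sign {a : F} (ha : a = 1 ∨ a = -1) : a * a = 1 := by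
  rcases ha with rfl | rfl <;> simp

lemma self_mem_DOrbit (h : SL3 F) : h ∈ DOrbit F h := by
  refine ⟨1, ⟨1, 0, Or.inl rfl, ?_⟩, by simp⟩
  ext i j
  fin_cases i <;> fin_cases j <;> simp

/-- The relations between the parameters of two elements of `H` in the same `D`-orbit. -/
lemma DOrbit_hElt_eq (h2 : (2 : F) ≠ 0) {a x y b u v : F} {ha : a * a = 1} {hb : b * b = 1}
    (h : DOrbit F (hElt a x y ha) = DOrbit F (hElt b u v hb)) :
    a = b ∧ ∃ c s : F, (c = 1 ∨ c = -1) ∧ y + s = a * s + v * c ∧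
      2 * x + 2 * s * y + s ^ 2 = a * s ^ 2 + 2 * u := by
  have hmem := self_mem_DOrbit (hElt a x y ha)
  rw [h] at hmem
  obtain ⟨d, ⟨c, s, hc, hd⟩, hconj⟩ := hmem
  have hc0 : c ≠ 0 := by rcases hc with rfl | rfl <;> simp
  have hcomm : d * hElt a x y ha = hElt b u v hb * d := by rw [hconj]; group
  have hmat : (d : Matrix (Fin 3) (Fin 3) F) * hMat F a x y =
      hMat F b u v * (d : Matrix (Fin 3) (Fin 3) F) := congrArg Subtype.val hcomm
  rw [hd] at hmat
  have h11 := congrFun (congrFun hmat 1) 1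
  have h12 := congrFun (congrFun hmat 1) 2
  have h02 := congrFun (congrFun hmat 0) 2
  simp [hMat, Matrix.mul_apply, Fin.sum_univ_three] at h11 h12 h02
  subst h11
  refine ⟨rfl, c, s, hc, h12, mul_left_cancel₀ hc0 ?_⟩
  field_simp at h02
  linear_combination c * h02

/-- Elements `h(1,x,y)` in the same `D`-orbit as `h(1,u,0)` equal it. -/
lemma DOrbit_one_zero (h2 : (2 : F) ≠ 0) {x u v : F} {h1 h1' : (1 : F) * 1 = 1}
    (h : DOrbit F (hElt 1 x 0 h1) = DOrbit F (hElt 1 u v h1')) : v = 0 := by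
  obtain ⟨-, c, s, hc, h₁, -⟩ := DOrbit_hElt_eq h2 h
  rcases hc with rfl | rfl
  · linear_combination -h₁
  · linear_combination h₁

/-- The quantity `x - y² / 4` is constant on the `D`-orbit of `h(-1,x,y)`. -/
lemma DOrbit_neg_one (h2 : (2 : F) ≠ 0) {x y u v : F} {h1 h1' : (-1 : F) * -1 = 1}
    (h : DOrbit F (hElt (-1) x y h1) = DOrbit F (hElt (-1) u v h1')) :
    4 * x - y ^ 2 = 4 * u - v ^ 2 := by
  obtain ⟨-, c, s, hc, h₁, h₂⟩ := DOrbit_hElt_eq h2 h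
  have hcc := mul_self_eq_one_of_sign hc
  linear_combination 2 * h₂ - (y + 2 * s + v * c) * h₁ - v ^ 2 * hcc

end HElements

/-- If `q ≥ 5` then `{e} ∪ P₀` separates the `G`-orbitals. -/
theorem stmt10 (F : Type*) [Field F] [Fintype F] (hodd : Odd (Fintype.card F))
    (hq : 5 ≤ Fintype.card F) :
    ∀ h₁ ∈ HSet F, ∀ h₂ ∈ HSet F,
      h₁ ∉ ({1} ∪ Porb F 0 : Set (SL3 F)) → h₂ ∉ ({1} ∪ Porb F 0 : Set (SL3 F)) →
      h₁ ≠ h₂ →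
      ∃ s ∈ ({1} ∪ Porb F 0 : Set (SL3 F)),
        DOrbit F (s * h₁⁻¹) ≠ DOrbit F (s * h₂⁻¹) := by
  have h2 : (2 : F) ≠ 0 := by
    intro h
    have hchar : ringChar F = 2 := by
      have := ringChar.dvd (R := F) (x := 2) (by exact_mod_cast h)
      exact ((Nat.dvd_prime Nat.prime_two).1 this).resolve_left CharP.ringChar_ne_one
    have := FiniteField.even_card_iff_char_two.1 hchar
    rw [Nat.odd_iff] at hodd
    omega
  rintro h₁ ⟨a, x, y, ha, hh₁⟩ h₂ ⟨b, u, v, hb, hh₂⟩ - - hne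
  obtain rfl : h₁ = hElt a x y (mul_self_eq_one_of_sign ha) := Subtype.ext hh₁
  obtain rfl : h₂ = hElt b u v (mul_self_eq_one_of_sign hb) := Subtype.ext hh₂
  by_contra! hsep
  have hone := hsep 1 (Or.inl rfl)
  have hpar (z : F) := hsep (hElt (-1) (0 + z ^ 2) (2 * z) (by ring)) (Or.inr ⟨z, rfl⟩)
  simp only [one_mul, hElt_inv, hElt_mul] at hone hpar
  obtain ⟨rfl, -⟩ := DOrbit_hElt_eq h2 hone
  apply hne
  suffices x = u ∧ y = v by obtain ⟨rfl, rfl⟩ := this; rfl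
  have h4 : (4 : F) ≠ 0 := by
    rw [show (4 : F) = 2 * 2 by ring]
    exact mul_ne_zero h2 h2
  rcases ha with rfl | rfl
  · simp only [mul_one] at hpar
    have hz := DOrbit_neg_one h2 (hpar 0)
    have ho := DOrbit_neg_one h2 (hpar 1)
    obtain rfl : y = v := mul_left_cancel₀ h4 (by linear_combination hz - ho)
    exact ⟨mul_left_cancel₀ h4 (by linear_combination hz), rfl⟩
  · have hinv := DOrbit_neg_one h2 hone
    have hy := hpar (y / 2)
    simp only [mul_neg, neg_mul, neg_neg, one_mul, mul_div_cancel₀ _ h2, neg_add_cancel] at hy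
    obtain rfl : y = v := by linear_combination DOrbit_one_zero h2 hy
    exact ⟨mul_left_cancel₀ h4 (by linear_combination hinv), rfl⟩
end

section
/- For each t ∈ F\{0}, let Φ_t be the subgraph of the Cayley graph Cay(H, C_t ∪ C_{−t}) induced on the vertex subset P_0. Then the map from P_0 to (F,+) sending h(−1, z², 2z) to 2z is a graph isomorphism from Φ_t to the Cayley graph Cay((F,+), {t, −t}). -/
open Matrix Pointwise

variable (F : Type*) [Field F]

lemma det_hMat {F : Type*} [Field F] (x y : F) : (hMat F (-1) x y).det = 1 := by
  simp [hMat, det_fin_three]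

lemma hMat_neg_one_mul {F : Type*} [Field F] (x y x' y' : F) :
    hMat F (-1) x y * hMat F (-1) x' y' = hMat F 1 (x - x') (y - y') := by
  ext i j
  fin_cases i <;> fin_cases j <;> simp [hMat, Matrix.mul_apply, Fin.sum_univ_three] <;> ring

lemma coe_mul_eq_hMat {F : Type*} [Field F] {g g' : SL3 F} {x y x' y' : F}
    (h : (g : Matrix (Fin 3) (Fin 3) F) = hMat F (-1) x y)
    (h' : (g' : Matrix (Fin 3) (Fin 3) F) = hMat F (-1) x' y') :
    ((g * g' : SL3 F) : Matrix (Fin 3) (Fin 3) F) = hMat F 1 (x - x') (y - y') :=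
  (Matrix.SpecialLinearGroup.coe_mul g g').trans <|
    (congrArg₂ (· * ·) h h').trans (hMat_neg_one_mul x y x' y')

lemma inv_eq_self_of_coe_eq_hMat {F : Type*} [Field F] {g : SL3 F} {x y : F}
    (h : (g : Matrix (Fin 3) (Fin 3) F) = hMat F (-1) x y) : g⁻¹ = g := by
  refine inv_eq_of_mul_eq_one_right (Subtype.ext ((coe_mul_eq_hMat h h).trans ?_))
  refine Eq.trans ?_ Matrix.SpecialLinearGroup.coe_one.symm
  ext i j
  fin_cases i <;> fin_cases j <;> simp [hMat]

lemma mem_Corb_iff_of_coe_eq_hMat {F : Type*} [Field F] {g : SL3 F} {x y t : F}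
    (h : (g : Matrix (Fin 3) (Fin 3) F) = hMat F 1 x y) : g ∈ Corb F t ↔ y = t := by
  constructor
  · rintro ⟨z, hz⟩
    simpa [hMat] using congrFun (congrFun (h.symm.trans hz) 1) 2
  · rintro rfl
    exact ⟨x, h⟩

/-- The map `h(-1,z²,2z) ↦ 2z`, as a bijection from `P₀` to `F`. -/
def porbZeroEquiv {F : Type*} [Field F] (h2 : (2 : F) ≠ 0) : ↥(Porb F 0) ≃ F where
  toFun g := (g : SL3 F).1 1 2
  invFun w := ⟨⟨hMat F (-1) (0 + (w / 2) ^ 2) (2 * (w / 2)), det_hMat _ _⟩, w / 2, rfl⟩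
  left_inv := by
    rintro ⟨g, z, hz⟩
    refine Subtype.ext (Subtype.ext ?_)
    have h : g.1 1 2 = 2 * z := by rw [hz]; simp [hMat]
    simp only [h, mul_div_cancel_left₀ z h2]
    exact hz.symm
  right_inv w := by simp [hMat, mul_div_cancel₀ w h2]

lemma porbZeroEquiv_apply {F : Type*} [Field F] (h2 : (2 : F) ≠ 0) {g : ↥(Porb F 0)} {x y : F}
    (h : ((g : SL3 F) : Matrix (Fin 3) (Fin 3) F) = hMat F (-1) x y) :
    porbZeroEquiv h2 g = y := by
  change ((g : SL3 F) : Matrix (Fin 3) (Fin 3) F) 1 2 = y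
  rw [h]
  simp [hMat]

/-- For `t ≠ 0`, the map `h(-1,z²,2z) ↦ 2z` is an isomorphism from the subgraph of
`Cay(H, C_t ∪ C_{-t})` induced on `P₀` to the Cayley graph `Cay((F,+), {t,-t})`. -/
theorem stmt12 (F : Type*) [Field F] [Fintype F] (hodd : Odd (Fintype.card F)) :
    ∀ t : F, t ≠ 0 →
      ∃ e : ↥(Porb F 0) ≃ F,
        (∀ (g : ↥(Porb F 0)) (z : F),
          ((g : SL3 F) : Matrix (Fin 3) (Fin 3) F) = hMat F (-1) (z ^ 2) (2 * z) →
          e g = 2 * z) ∧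
        ∀ g₁ g₂ : ↥(Porb F 0),
          ((g₁ : SL3 F) * (g₂ : SL3 F)⁻¹ ∈ Corb F t ∪ Corb F (-t)) ↔
            (e g₁ - e g₂ = t ∨ e g₁ - e g₂ = -t) := by
  intro t _
  have h2 : (2 : F) ≠ 0 := by
    refine Ring.two_ne_zero fun h => ?_
    have := FiniteField.even_card_of_char_two h
    rw [Nat.odd_iff] at hodd
    omega
  refine ⟨porbZeroEquiv h2, fun g z hz => porbZeroEquiv_apply h2 hz, fun g₁ g₂ => ?_⟩
  obtain ⟨z₁, h₁⟩ := g₁.2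
  obtain ⟨z₂, h₂⟩ := g₂.2
  have h : (((g₁ : SL3 F) * (g₂ : SL3 F)⁻¹ : SL3 F) : Matrix (Fin 3) (Fin 3) F) =
      hMat F 1 (0 + z₁ ^ 2 - (0 + z₂ ^ 2)) (2 * z₁ - 2 * z₂) := by
    rw [inv_eq_self_of_coe_eq_hMat h₂]
    exact coe_mul_eq_hMat h₁ h₂
  rw [Set.mem_union, mem_Corb_iff_of_coe_eq_hMat h, mem_Corb_iff_of_coe_eq_hMat h,
    porbZeroEquiv_apply h2 h₁, porbZeroEquiv_apply h2 h₂]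
end

section
/- Let q be a prime with q > 7 and F = F_q, and let x ∈ F satisfy x ∉ {0, 1, −1, 2, −2, 1/2} and x⁶ ≠ 1. Set T = P_0 ∪ P_1 ∪ P_x ∪ C_1 ∪ C_{−1} and T' = P_0 ∪ P_{−1} ∪ P_{−x} ∪ C_1 ∪ C_{−1} (both are inverse-closed subsets of H). Then the Cayley graphs Cay(H,T) and Cay(H,T') are isomorphic, but there exists no group automorphism β of H with β(T) = T'. In particular, Cay(H,T) is not a DCI-graph and H is not a CI-group. -/
open Matrix Pointwise

variable (F : Type*) [Field F]

def IsDCIGraph {R : Type*} [Group R] (S : Set R) : Prop :=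
  ∀ T : Set R,
    (∃ e : R ≃ R, ∀ x y : R, x * y⁻¹ ∈ S ↔ e x * (e y)⁻¹ ∈ T) →
    ∃ φ : R ≃* R, φ '' S = T

def IsCIGroup (R : Type*) [Group R] : Prop := ∀ S : Set R, S⁻¹ = S → IsDCIGraph S

section GeneralizedDihedral

variable {F}

/-- The matrix `h(ε,x,y)` as an element of `SL₃(F)`, for a sign `ε`. -/
def hElem (ε : ℤˣ) (x y : F) : SL3 F :=
  ⟨hMat F ((ε : ℤ) : F) x y, by
    rcases Int.units_eq_one_or ε with rfl | rfl <;> simp [hMat, Matrix.det_fin_three]⟩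

theorem coe_hElem (ε : ℤˣ) (x y : F) :
    (hElem ε x y : Matrix (Fin 3) (Fin 3) F) = hMat F ((ε : ℤ) : F) x y := rfl

theorem hMat_inj {a x y b x' y' : F} :
    hMat F a x y = hMat F b x' y' ↔ a = b ∧ x = x' ∧ y = y' := by
  refine ⟨fun h => ⟨?_, ?_, ?_⟩, by rintro ⟨rfl, rfl, rfl⟩; rfl⟩
  · simpa [hMat] using congrFun₂ h 0 0
  · simpa [hMat] using congrFun₂ h 0 2
  · simpa [hMat] using congrFun₂ h 1 2

theorem cast_units_inj (h2 : (2 : F) ≠ 0) {ε δ : ℤˣ} :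
    ((ε : ℤ) : F) = ((δ : ℤ) : F) ↔ ε = δ := by
  have h : (1 : F) ≠ -1 := fun h => h2 (by linear_combination h)
  rcases Int.units_eq_one_or ε with rfl | rfl <;>
    rcases Int.units_eq_one_or δ with rfl | rfl <;> simp [h, h.symm]

theorem hElem_inj (h2 : (2 : F) ≠ 0) {ε δ : ℤˣ} {x y x' y' : F} :
    hElem ε x y = hElem δ x' y' ↔ ε = δ ∧ x = x' ∧ y = y' := by
  rw [← cast_units_inj h2, ← hMat_inj]
  exact Subtype.ext_iff

theorem hElem_mul (ε δ : ℤˣ) (x y x' y' : F) :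
    hElem ε x y * hElem δ x' y' =
      hElem (ε * δ) (x + ((ε : ℤ) : F) * x') (y + ((ε : ℤ) : F) * y') := by
  apply Subtype.ext
  rw [Matrix.SpecialLinearGroup.coe_mul]
  simp only [coe_hElem, hMat]
  ext i j
  fin_cases i <;> fin_cases j <;> simp [Matrix.mul_apply, Fin.sum_univ_three, add_comm]

theorem hElem_one_zero : hElem (F := F) 1 0 0 = 1 := by
  apply Subtype.ext
  ext i j
  fin_cases i <;> fin_cases j <;> simp [coe_hElem, hMat]

theorem hElem_inv (ε : ℤˣ) (x y : F) :
    (hElem ε x y)⁻¹ = hElem ε (-((ε : ℤ) : F) * x) (-((ε : ℤ) : F) * y) := by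
  rw [inv_eq_iff_mul_eq_one, hElem_mul, ← hElem_one_zero]
  rcases Int.units_eq_one_or ε with rfl | rfl <;> simp

theorem mem_HSet_iff {g : SL3 F} : g ∈ HSet F ↔ ∃ ε x y, g = hElem ε x y := by
  constructor
  · rintro ⟨a, x, y, rfl | rfl, h⟩
    · exact ⟨1, x, y, Subtype.ext (by simpa [coe_hElem] using h)⟩
    · exact ⟨-1, x, y, Subtype.ext (by simpa [coe_hElem] using h)⟩
  · rintro ⟨ε, x, y, rfl⟩
    refine ⟨((ε : ℤ) : F), x, y, ?_, rfl⟩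
    rcases Int.units_eq_one_or ε with rfl | rfl <;> simp

theorem hElem_mem_Corb (h2 : (2 : F) ≠ 0) {ε : ℤˣ} {x y t : F} :
    hElem ε x y ∈ Corb F t ↔ ε = 1 ∧ y = t := by
  have h := cast_units_inj h2 (ε := ε) (δ := 1)
  simp only [Units.val_one, Int.cast_one] at h
  simp [Corb, coe_hElem, hMat_inj, h]

theorem hElem_mem_Porb (h2 : (2 : F) ≠ 0) {ε : ℤˣ} {x y t : F} :
    hElem ε x y ∈ Porb F t ↔ ε = -1 ∧ x - (y / 2) ^ 2 = t := by
  have h := cast_units_inj h2 (ε := ε) (δ := -1)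
  simp only [Units.val_neg, Units.val_one, Int.cast_neg, Int.cast_one] at h
  simp only [Porb, Set.mem_ofPred_eq, coe_hElem, hMat_inj, h]
  constructor
  · rintro ⟨z, hε, rfl, rfl⟩
    exact ⟨hε, by field_simp; ring⟩
  · rintro ⟨hε, rfl⟩
    exact ⟨y / 2, hε, by ring, by field_simp⟩

/-- The union of the sets `P_t` for `t ∈ {r, s, t}`, together with `C_1` and `C_{-1}`. -/
def connectionSet (r s t : F) : Set (SL3 F) :=
  Porb F r ∪ Porb F s ∪ Porb F t ∪ Corb F 1 ∪ Corb F (-1)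

theorem hElem_one_mem_connectionSet (h2 : (2 : F) ≠ 0) {x y r s t : F} :
    hElem 1 x y ∈ connectionSet r s t ↔ y = 1 ∨ y = -1 := by
  have h : (1 : ℤˣ) ≠ -1 := by decide
  simp only [connectionSet, Set.mem_union, hElem_mem_Porb h2, hElem_mem_Corb h2, h]
  tauto

theorem hElem_neg_one_mem_connectionSet (h2 : (2 : F) ≠ 0) {x y r s t : F} :
    hElem (-1) x y ∈ connectionSet r s t ↔
      x - (y / 2) ^ 2 = r ∨ x - (y / 2) ^ 2 = s ∨ x - (y / 2) ^ 2 = t := by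
  have h : (-1 : ℤˣ) ≠ 1 := by decide
  simp only [connectionSet, Set.mem_union, hElem_mem_Porb h2, hElem_mem_Corb h2, h]
  tauto

theorem connectionSet_subset_HSet (r s t : F) : connectionSet r s t ⊆ HSet F := by
  rintro g ((((⟨z, h⟩ | ⟨z, h⟩) | ⟨z, h⟩) | ⟨z, h⟩) | ⟨z, h⟩)
  exacts [⟨-1, _, _, .inr rfl, h⟩, ⟨-1, _, _, .inr rfl, h⟩, ⟨-1, _, _, .inr rfl, h⟩,
    ⟨1, _, _, .inl rfl, h⟩, ⟨1, _, _, .inl rfl, h⟩]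

theorem connectionSet_inv (h2 : (2 : F) ≠ 0) (r s t : F) :
    (connectionSet r s t)⁻¹ = connectionSet r s t := by
  have key : ∀ g ∈ connectionSet r s t, g⁻¹ ∈ connectionSet r s t := by
    intro g hg
    obtain ⟨ε, x, y, rfl⟩ := mem_HSet_iff.1 (connectionSet_subset_HSet r s t hg)
    rw [hElem_inv]
    rcases Int.units_eq_one_or ε with rfl | rfl
    · rw [hElem_one_mem_connectionSet h2] at hg ⊢
      rcases hg with rfl | rfl <;> simp
    · simpa using hg
  exact Set.Subset.antisymm (fun g hg => by simpa using key _ hg) key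

/-- `H` is parametrised by the triples `(ε,x,y)`. -/
noncomputable def hEquiv (h2 : (2 : F) ≠ 0) (H : Subgroup (SL3 F))
    (hH : (H : Set (SL3 F)) = HSet F) : ℤˣ × F × F ≃ H :=
  Equiv.ofBijective
    (fun p => ⟨hElem p.1 p.2.1 p.2.2, by
      rw [← SetLike.mem_coe, hH]; exact mem_HSet_iff.2 ⟨_, _, _, rfl⟩⟩) <| by
    constructor
    · rintro ⟨ε, x, y⟩ ⟨δ, x', y'⟩ h
      simpa [hElem_inj h2] using h
    · rintro ⟨g, hg⟩
      rw [← SetLike.mem_coe, hH] at hg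
      obtain ⟨ε, x, y, rfl⟩ := mem_HSet_iff.1 hg
      exact ⟨(ε, x, y), rfl⟩

theorem coe_hEquiv (h2 : (2 : F) ≠ 0) (H : Subgroup (SL3 F))
    (hH : (H : Set (SL3 F)) = HSet F) (p : ℤˣ × F × F) :
    (hEquiv h2 H hH p : SL3 F) = hElem p.1 p.2.1 p.2.2 := rfl

/-- The map `(ε,x,y) ↦ (ε, y²/2 - x, -εy)`, which reflects the parabolas `P_t` to `P_{-t}`. -/
def parabolaFlip : ℤˣ × F × F ≃ ℤˣ × F × F :=
  Function.Involutive.toPerm (fun p => (p.1, p.2.2 ^ 2 / 2 - p.2.1, -((p.1 : ℤ) : F) * p.2.2)) <| by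
    rintro ⟨ε, x, y⟩
    rcases Int.units_eq_one_or ε with rfl | rfl <;> simp

theorem parabolaFlip_apply (ε : ℤˣ) (x y : F) :
    parabolaFlip (ε, x, y) = (ε, y ^ 2 / 2 - x, -((ε : ℤ) : F) * y) := rfl

theorem exists_cayley_iso (h2 : (2 : F) ≠ 0) (H : Subgroup (SL3 F))
    (hH : (H : Set (SL3 F)) = HSet F) (r s t : F) :
    ∃ e : H ≃ H, ∀ u v : H, ((u : SL3 F) * (v : SL3 F)⁻¹ ∈ connectionSet r s t) ↔
      ((e u : SL3 F) * ((e v : SL3 F))⁻¹ ∈ connectionSet (-r) (-s) (-t)) := by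
  refine ⟨(hEquiv h2 H hH).symm.trans (parabolaFlip.trans (hEquiv h2 H hH)), fun u v => ?_⟩
  obtain ⟨⟨ε, x, y⟩, rfl⟩ := (hEquiv h2 H hH).surjective u
  obtain ⟨⟨δ, x', y'⟩, rfl⟩ := (hEquiv h2 H hH).surjective v
  have hneg : ∀ a b c : F, a = -b → (a = -c ↔ b = c) := by
    rintro a b c rfl
    exact neg_inj
  simp only [Equiv.trans_apply, Equiv.symm_apply_apply, coe_hEquiv, parabolaFlip_apply,
    hElem_inv, hElem_mul]
  have hy : ∀ a b : F, b = -a → ((a = 1 ∨ a = -1) ↔ (b = 1 ∨ b = -1)) := by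
    rintro a b rfl
    rw [neg_inj, neg_eq_iff_eq_neg]
    exact or_comm
  rcases Int.units_eq_one_or ε with rfl | rfl <;> rcases Int.units_eq_one_or δ with rfl | rfl
  · simp only [mul_one, hElem_one_mem_connectionSet h2]
    exact hy _ _ (by push_cast; ring)
  · simp only [one_mul, hElem_neg_one_mem_connectionSet h2]
    rw [hneg, hneg, hneg] <;> (push_cast; field_simp; ring)
  · simp only [mul_one, hElem_neg_one_mem_connectionSet h2]
    rw [hneg, hneg, hneg] <;> (push_cast; field_simp; ring)
  · simp only [neg_mul_neg, mul_one, hElem_one_mem_connectionSet h2]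
    apply iff_of_eq
    congr 2 <;> (push_cast; ring)

theorem addMonoidHom_apply_of_prime_card [Fintype F] (hq : (Fintype.card F).Prime)
    (f : F →+ F) (a : F) : f a = f 1 * a := by
  have := Fact.mk hq
  have h : a ∈ AddSubgroup.zmultiples (1 : F) :=
    mem_zmultiples_of_prime_card (p := Fintype.card F) Nat.card_eq_fintype_card one_ne_zero
  obtain ⟨n, rfl⟩ := AddSubgroup.mem_zmultiples_iff.1 h
  rw [map_zsmul, mul_smul_comm, mul_one]

theorem natCast_ne_zero_of_prime_card [Fintype F] (hq : (Fintype.card F).Prime) {n : ℕ}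
    (hn : 0 < n) (hlt : n < Fintype.card F) : (n : F) ≠ 0 := by
  have h : ringChar F = Fintype.card F :=
    (Nat.prime_dvd_prime_iff_eq (CharP.char_is_prime F (ringChar F)) hq).1
      ((ringChar.spec F _).1 (Nat.cast_card_eq_zero F))
  rw [Ne, ringChar.spec, h]
  exact Nat.not_dvd_of_pos_of_lt hn hlt

/-- No affine map preserving the family of lines `y = const` carries three translated parabolas
with parameters `0, 1, x` to those with parameters `0, -1, -x`. -/
theorem no_affine_parabola_map (h2 : (2 : F) ≠ 0) (h3 : (3 : F) ≠ 0) {x : F}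
    (hx : x ∉ ({0, 1, -1, 2, -2, 1 / 2} : Set F)) {α γ b c d : F} (hα : α ≠ 0) (hb : b ^ 2 = 1)
    (h : ∀ y s : F, s = 0 ∨ s = 1 ∨ s = x →
      α * (s + (y / 2) ^ 2) + γ * y + c - ((b * y + d) / 2) ^ 2 = 0 ∨
      α * (s + (y / 2) ^ 2) + γ * y + c - ((b * y + d) / 2) ^ 2 = -1 ∨
      α * (s + (y / 2) ^ 2) + γ * y + c - ((b * y + d) / 2) ^ 2 = -x) : False := by
  classical
  simp only [Set.mem_insert_iff, Set.mem_singleton_iff, not_or] at hx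
  obtain ⟨hx0, hx1, hxn1, hx2, -, hxh⟩ := hx
  have hsum : ∀ y : F, α * (1 + x) +
      3 * (α * (y / 2) ^ 2 + γ * y + c - ((b * y + d) / 2) ^ 2) = -(1 + x) := by
    intro y
    set k := α * (y / 2) ^ 2 + γ * y + c - ((b * y + d) / 2) ^ 2 with hk
    let S : Finset F := {0, 1, x}
    let f : F → F := fun s => -(α * s + k)
    have hf : Function.Injective f := by
      intro s s' hs
      have hs' : -(α * s + k) = -(α * s' + k) := hs
      exact mul_left_cancel₀ hα (by linear_combination -hs')
    have hsub : S.image f ⊆ S := by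
      intro z hz
      obtain ⟨s, hs, rfl⟩ := Finset.mem_image.1 hz
      have := h y s (by simpa [S] using hs)
      simp only [S, f, Finset.mem_insert, Finset.mem_singleton]
      rcases this with h | h | h
      · left; linear_combination -h
      · right; left; linear_combination -h
      · right; right; linear_combination -h
    have himg : S.image f = S :=
      Finset.eq_of_subset_of_card_le hsub (Finset.card_image_of_injective S hf).ge
    have hs : ∑ s ∈ S, f s = ∑ s ∈ S, s := by
      conv_rhs => rw [← himg, Finset.sum_image hf.injOn]
    have e : ∀ g : F → F, ∑ s ∈ S, g s = g 0 + (g 1 + g x) := by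
      intro g
      rw [Finset.sum_insert, Finset.sum_pair (Ne.symm hx1)]
      simp [Ne.symm hx0]
    rw [e, e] at hs
    simp only [f] at hs
    linear_combination -hs
  have hα1 : α = 1 := by
    have h0 := hsum 0
    have h1 := hsum 1
    have h1' := hsum (-1)
    have : 3 * (α - 1) = 0 := by
      field_simp at h0 h1 h1'
      apply mul_left_cancel₀ h2
      linear_combination h1 + h1' - 2 * h0 + 6 * hb
    simpa [h3, sub_eq_zero] using this
  subst hα1
  have h0 := h 0 0 (by simp)
  have h1 := h 0 1 (by simp)
  have hX := h 0 x (by simp)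
  generalize hk : c - (d / 2) ^ 2 = k at *
  have e : ∀ s : F, 1 * (s + (0 / 2) ^ 2) + γ * 0 + c - ((b * 0 + d) / 2) ^ 2 = s + k := by
    intro s
    rw [← hk]; ring
  rw [e] at h0 h1 hX
  rw [zero_add] at h0
  have hh : 2 * x ≠ 1 := fun H => hxh (by field_simp; linear_combination H)
  rcases h0 with rfl | rfl | rfl
  · rcases h1 with h | h | h
    · simp at h
    · exact h2 (by linear_combination h)
    · exact hxn1 (by linear_combination h)
  · rcases hX with h | h | h
    · exact hx1 (by linear_combination h)
    · exact hx0 (by linear_combination h)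
    · exact hh (by linear_combination h)
  · rcases h1 with h | h | h
    · exact hx1 (by linear_combination -h)
    · exact hx2 (by linear_combination -h)
    · exact one_ne_zero (by linear_combination h)

/-- Automorphisms of `H` are affine when `F` has prime order. -/
theorem mulEquiv_affine [Fintype F] (hq : (Fintype.card F).Prime) (h2 : (2 : F) ≠ 0)
    (H : Subgroup (SL3 F)) (hH : (H : Set (SL3 F)) = HSet F) (β : H ≃* H) :
    ∃ α γ a b c d : F, ∀ x y : F,
      β (hEquiv h2 H hH (1, x, y)) = hEquiv h2 H hH (1, α * x + γ * y, a * x + b * y) ∧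
      β (hEquiv h2 H hH (-1, x, y)) =
        hEquiv h2 H hH (-1, α * x + γ * y + c, a * x + b * y + d) := by
  set h := hEquiv h2 H hH with hdef
  have hmul : ∀ (ε δ : ℤˣ) (x y x' y' : F), h (ε, x, y) * h (δ, x', y') =
      h (ε * δ, x + ((ε : ℤ) : F) * x', y + ((ε : ℤ) : F) * y') :=
    fun ε δ x y x' y' => Subtype.ext (hElem_mul ε δ x y x' y')
  have hone : h (1, 0, 0) = 1 := Subtype.ext hElem_one_zero
  have hrot : ∀ p : F × F, ∃ p' : F × F, β (h (1, p)) = h (1, p') := by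
    rintro ⟨x, y⟩
    obtain ⟨⟨ε, u, v⟩, huv⟩ := h.surjective (β (h (1, x / 2, y / 2)))
    have hsq : h (1, x, y) = h (1, x / 2, y / 2) * h (1, x / 2, y / 2) := by
      rw [hmul]
      simp [← two_mul, mul_div_cancel₀ _ h2]
    rw [hsq, map_mul, ← huv, hmul, Int.units_mul_self]
    exact ⟨_, rfl⟩
  choose A hA using hrot
  let φ : F × F →+ F × F := AddMonoidHom.mk' A <| by
    rintro ⟨x, y⟩ ⟨x', y'⟩
    have e : h (1, (x, y) + (x', y')) = h (1, x, y) * h (1, x', y') := by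
      rw [hmul]
      simp
    have := hA ((x, y) + (x', y'))
    rw [e, map_mul, hA, hA] at this
    have e' : h (1, A (x, y)) * h (1, A (x', y')) = h (1, A (x, y) + A (x', y')) := by
      rw [← Prod.mk.eta (p := A (x, y)), ← Prod.mk.eta (p := A (x', y')), hmul]
      simp [Prod.add_def]
    rw [e'] at this
    exact (Prod.ext_iff.1 (h.injective this)).2.symm
  have hlin : ∀ (ψ : F × F →+ F) (x y : F), ψ (x, y) = ψ (1, 0) * x + ψ (0, 1) * y := by
    intro ψ x y
    have e : (x, y) = (x, 0) + (0, y) := by simp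
    rw [e, map_add]
    congr 1
    · exact addMonoidHom_apply_of_prime_card hq (ψ.comp (AddMonoidHom.inl F F)) x
    · exact addMonoidHom_apply_of_prime_card hq (ψ.comp (AddMonoidHom.inr F F)) y
  obtain ⟨⟨ε, c, d⟩, hcd⟩ := h.surjective (β (h (-1, 0, 0)))
  have hε : ε = -1 := by
    refine (Int.units_eq_one_or ε).resolve_left ?_
    rintro rfl
    have hs : h (1, c, d) * h (1, c, d) = h (1, 0, 0) := by
      rw [hcd, ← map_mul, hmul]
      simp [hone]
    rw [hmul] at hs
    have hs' := h.injective hs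
    simp only [Prod.mk.injEq, Units.val_one, Int.cast_one, one_mul, ← two_mul, mul_eq_zero, h2,
      false_or] at hs'
    rw [hs'.2.1, hs'.2.2, hone] at hcd
    have := (map_eq_one_iff β β.injective).1 hcd.symm
    rw [← hone] at this
    have : (-1 : ℤˣ) = 1 := congrArg Prod.fst (h.injective this)
    exact absurd this (by decide)
  subst hε
  have hA' : ∀ x y : F, A (x, y) = ((A (1, 0)).1 * x + (A (0, 1)).1 * y,
      (A (1, 0)).2 * x + (A (0, 1)).2 * y) := fun x y =>
    Prod.ext (hlin ((AddMonoidHom.fst F F).comp φ) x y) (hlin ((AddMonoidHom.snd F F).comp φ) x y)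
  refine ⟨(A (1, 0)).1, (A (0, 1)).1, (A (1, 0)).2, (A (0, 1)).2, c, d, fun x y => ⟨?_, ?_⟩⟩
  · rw [hA, hA']
  · have e : h (-1, x, y) = h (1, x, y) * h (-1, 0, 0) := by
      rw [hmul]
      simp
    rw [e, map_mul, hA, hA', ← hcd, hmul]
    simp

theorem not_exists_mulEquiv [Fintype F] (hq : (Fintype.card F).Prime) (h2 : (2 : F) ≠ 0)
    (h3 : (3 : F) ≠ 0) {x : F} (hx : x ∉ ({0, 1, -1, 2, -2, 1 / 2} : Set F))
    (H : Subgroup (SL3 F)) (hH : (H : Set (SL3 F)) = HSet F) :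
    ¬ ∃ β : H ≃* H, ∀ u : H, ((u : SL3 F) ∈ connectionSet 0 1 x ↔
      (β u : SL3 F) ∈ connectionSet 0 (-1) (-x)) := by
  rintro ⟨β, hβ⟩
  obtain ⟨α, γ, a, b, c, d, h⟩ := mulEquiv_affine hq h2 H hH β
  have hrot : ∀ u v : F, (v = 1 ∨ v = -1) ↔ (a * u + b * v = 1 ∨ a * u + b * v = -1) := by
    intro u v
    have := hβ (hEquiv h2 H hH (1, u, v))
    rwa [(h u v).1, coe_hEquiv, coe_hEquiv, hElem_one_mem_connectionSet h2,
      hElem_one_mem_connectionSet h2] at this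
  have ha : a = 0 := by
    by_contra ha
    have := (hrot (-b / a) 1).1 (.inl rfl)
    rw [mul_div_cancel₀ _ ha] at this
    simp at this
  subst ha
  have hb : b ^ 2 = 1 := by
    have := (hrot 0 1).1 (.inl rfl)
    simpa using this
  have hα : α ≠ 0 := by
    rintro rfl
    have e : β (hEquiv h2 H hH (1, 1, 0)) = β (hEquiv h2 H hH (1, 0, 0)) := by
      rw [(h 1 0).1, (h 0 0).1]
      simp
    have := (hEquiv h2 H hH).injective (β.injective e)
    simp at this
  refine no_affine_parabola_map h2 h3 hx (γ := γ) (c := c) (d := d) hα hb fun y s hs => ?_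
  have := (hβ (hEquiv h2 H hH (-1, s + (y / 2) ^ 2, y))).1 (by
    rw [coe_hEquiv, hElem_neg_one_mem_connectionSet h2]
    simpa using hs)
  rw [(h _ _).2, coe_hEquiv, hElem_neg_one_mem_connectionSet h2] at this
  simpa using this

end GeneralizedDihedral

theorem stmt15 (F : Type*) [Field F] [Fintype F]
    (hq : (Fintype.card F).Prime) (hq7 : 7 < Fintype.card F)
    (x : F) (hx : x ∉ ({0, 1, -1, 2, -2, 1 / 2} : Set F)) (hx6 : x ^ 6 ≠ 1)
    (H : Subgroup (SL3 F)) (hH : (H : Set (SL3 F)) = HSet F)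
    (T T' : Set (SL3 F))
    (hT : T = Porb F 0 ∪ Porb F 1 ∪ Porb F x ∪ Corb F 1 ∪ Corb F (-1))
    (hT' : T' = Porb F 0 ∪ Porb F (-1) ∪ Porb F (-x) ∪ Corb F 1 ∪ Corb F (-1)) :
    -- both connection sets are inverse-closed
    T⁻¹ = T ∧ T'⁻¹ = T' ∧
    -- `Cay(H,T)` and `Cay(H,T')` are isomorphic graphs
    (∃ e : H ≃ H, ∀ u v : H,
      ((u : SL3 F) * (v : SL3 F)⁻¹ ∈ T) ↔ ((e u : SL3 F) * ((e v : SL3 F))⁻¹ ∈ T')) ∧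
    -- but no group automorphism of `H` carries `T` to `T'`
    (¬ ∃ β : H ≃* H, ∀ u : H, ((u : SL3 F) ∈ T ↔ (β u : SL3 F) ∈ T')) ∧
    -- in particular, `Cay(H,T)` is not a DCI-graph and `H` is not a CI-group
    ¬ IsDCIGraph {u : H | (u : SL3 F) ∈ T} ∧ ¬ IsCIGroup H := by
  have h2 : (2 : F) ≠ 0 := by
    exact_mod_cast natCast_ne_zero_of_prime_card hq (n := 2) (by lia) (by lia)
  have h3 : (3 : F) ≠ 0 := by
    exact_mod_cast natCast_ne_zero_of_prime_card hq (n := 3) (by lia) (by lia)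
  replace hT : T = connectionSet 0 1 x := hT
  replace hT' : T' = connectionSet 0 (-1) (-x) := hT'
  subst hT hT'
  have hiso := exists_cayley_iso h2 H hH 0 1 x
  rw [neg_zero] at hiso
  have hnot := not_exists_mulEquiv hq h2 h3 hx H hH
  have hDCI : ¬ IsDCIGraph {u : H | (u : SL3 F) ∈ connectionSet 0 1 x} := by
    intro hD
    obtain ⟨φ, hφ⟩ := hD {u : H | (u : SL3 F) ∈ connectionSet 0 (-1) (-x)} hiso
    refine hnot ⟨φ, fun u => ?_⟩
    have := φ.injective.mem_set_image (s := {u : H | (u : SL3 F) ∈ connectionSet 0 1 x}) (a := u)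
    rw [hφ] at this
    exact this.symm
  refine ⟨connectionSet_inv h2 _ _ _, connectionSet_inv h2 _ _ _, hiso, hnot, hDCI,
    fun hCI => hDCI (hCI _ ?_)⟩
  ext u
  change (u : SL3 F)⁻¹ ∈ connectionSet 0 1 x ↔ (u : SL3 F) ∈ connectionSet 0 1 x
  rw [← Set.mem_inv, connectionSet_inv h2]
end
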